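/- Let N ≥ 2 and 0 < R₀ < R₁. Suppose s ∈ [0, R₁ + R₀) and L ∈ ℝ are such that (λ₁(p, Ω_s))^{1/p} → L as p → ∞. Then L = 2/(R₁ − R₀ + s). -/

import Mathlib

open MeasureTheory Metric Set Filter
open scoped RealInnerProductSpace ENNReal Topology

/-- The first Dirichlet eigenvalue of the p-Laplacian on `Ω`, defined variationally as the
infimum of Rayleigh quotients of smooth, not identically zero functions with compact
support contained in `Ω`. -/
noncomputable def lam1 {N : ℕ} (p : ℝ) (Ω : Set (EuclideanSpace ℝ (Fin N))) : ℝ :=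
  sInf { r : ℝ | ∃ u : EuclideanSpace ℝ (Fin N) → ℝ,
    ContDiff ℝ (⊤ : ℕ∞) u ∧ u ≠ 0 ∧ HasCompactSupport u ∧ tsupport u ⊆ Ω ∧
    r = (∫ x in Ω, ‖gradient u x‖ ^ p) / (∫ x in Ω, |u x| ^ p) }

/-- The first standard basis vector `e₁` of `ℝ^N`. -/
noncomputable def e1 (N : ℕ) : EuclideanSpace ℝ (Fin N) :=
  (WithLp.equiv 2 (Fin N → ℝ)).symm (fun i => if (i : ℕ) = 0 then 1 else 0)

/-- The eccentric annulus `Ω_s = B_{R₁}(0) \ closure (B_{R₀}(s e₁))`. -/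
noncomputable def Om (N : ℕ) (R₀ R₁ s : ℝ) : Set (EuclideanSpace ℝ (Fin N)) :=
  ball 0 R₁ \ closure (ball (s • e1 N) R₀)

/-- `u` is a first eigenfunction of the p-Laplacian on `Ω` with eigenvalue `lam`:
C¹ on an open set containing the closure of `Ω`, positive in `Ω`, zero on `∂Ω`, and a weak
solution of `−Δ_p u = lam · u^{p−1}`. -/
def IsFirstEigenfunction {N : ℕ} (p : ℝ) (Ω : Set (EuclideanSpace ℝ (Fin N)))
    (lam : ℝ) (u : EuclideanSpace ℝ (Fin N) → ℝ) : Prop :=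
  (∃ V : Set (EuclideanSpace ℝ (Fin N)), IsOpen V ∧ closure Ω ⊆ V ∧ ContDiffOn ℝ 1 u V) ∧
  (∀ x ∈ Ω, 0 < u x) ∧
  (∀ x ∈ frontier Ω, u x = 0) ∧
  (∀ φ : EuclideanSpace ℝ (Fin N) → ℝ, ContDiff ℝ (⊤ : ℕ∞) φ → HasCompactSupport φ →
    tsupport φ ⊆ Ω →
    ∫ x in Ω, ‖gradient u x‖ ^ (p - 2) * ⟪gradient u x, gradient φ x⟫ =
      lam * ∫ x in Ω, (u x) ^ (p - 1) * φ x)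

lemma morrey1 {N : ℕ} (u : EuclideanSpace ℝ (Fin N) → ℝ) (hu : ContDiff ℝ 1 u)
    (x y : EuclideanSpace ℝ (Fin N)) (D : ℝ) (hD : ‖y - x‖ ≤ D) (hy : u y = 0) :
    ‖u x‖ₑ ≤ ENNReal.ofReal D * ∫⁻ t in Ioc (0:ℝ) 1, ‖fderiv ℝ u (x + t • (y - x))‖ₑ := by
  have hd : ∀ t : ℝ, HasDerivAt (fun t : ℝ => u (x + t • (y - x)))
      (fderiv ℝ u (x + t • (y - x)) (y - x)) t := by
    intro t
    have h1 : HasDerivAt (fun t : ℝ => x + t • (y - x)) (y - x) t := by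
      simpa using ((hasDerivAt_id t).smul_const (y - x)).const_add x
    have h2 := ((hu.differentiable one_ne_zero) (x + t • (y - x))).hasFDerivAt
    exact h2.comp_hasDerivAt t h1
  have hcont : Continuous (fun t : ℝ => fderiv ℝ u (x + t • (y - x)) (y - x)) := by
    have := hu.continuous_fderiv one_ne_zero
    fun_prop
  have h := intervalIntegral.integral_eq_sub_of_hasDerivAt (a := 0) (b := 1)
    (fun t _ => hd t) (hcont.intervalIntegrable _ _)
  have h3 : u x = - ∫ t in Ioc (0:ℝ) 1, fderiv ℝ u (x + t • (y - x)) (y - x) := by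
    rw [← intervalIntegral.integral_of_le zero_le_one, h]
    simp [hy]
  rw [h3, enorm_neg]
  refine (enorm_integral_le_lintegral_enorm _).trans ?_
  rw [← lintegral_const_mul' _ _ ENNReal.ofReal_ne_top]
  refine lintegral_mono fun t => ?_
  rw [mul_comm]
  refine (ContinuousLinearMap.le_opENorm _ _).trans ?_
  gcongr
  rw [← ofReal_norm]
  exact ENNReal.ofReal_le_ofReal hD

lemma scale {N : ℕ} (f : EuclideanSpace ℝ (Fin N) → ℝ≥0∞) (hf : Measurable f)
    (a : EuclideanSpace ℝ (Fin N)) (t : ℝ) (ht : 0 < t) :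
    ∫⁻ z, f (a + t • z) = ENNReal.ofReal (t ^ (-(N:ℝ))) * ∫⁻ z, f z := by
  have h1 : ∫⁻ z, f (a + t • z) = ∫⁻ z, f (a + z) ∂(Measure.map (t • ·) volume) := by
    rw [lintegral_map (by fun_prop) (by fun_prop)]
  rw [h1, Measure.map_addHaar_smul _ ht.ne', lintegral_smul_measure, lintegral_add_left_eq_self]
  simp only [finrank_euclideanSpace, Fintype.card_fin, smul_eq_mul]
  congr 2
  rw [abs_of_nonneg (by positivity), Real.rpow_neg ht.le, Real.rpow_natCast]

lemma inner_est {N : ℕ} (g : EuclideanSpace ℝ (Fin N) → ℝ≥0∞) (hg : Measurable g)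
    (p : ℝ) (hp1 : 1 < p)
    (a : EuclideanSpace ℝ (Fin N)) (t : ℝ) (ht : 0 < t) (B : Set (EuclideanSpace ℝ (Fin N))) :
    ∫⁻ z in B, g (a + t • z) ≤ ENNReal.ofReal (t ^ (-(N:ℝ)/p)) *
      ((∫⁻ z, g z ^ p) ^ (1/p) * volume B ^ (1 - 1/p)) := by
  have h := ENNReal.lintegral_mul_le_Lp_mul_Lq (volume.restrict B)
    (Real.HolderConjugate.conjExponent hp1) (f := fun z => g (a + t • z)) (g := fun _ => 1)
    (by fun_prop) (by fun_prop)
  simp only [Pi.mul_apply, mul_one, ENNReal.one_rpow, lintegral_const, one_mul,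
    Measure.restrict_apply MeasurableSet.univ, univ_inter] at h
  refine h.trans ?_
  rw [← mul_assoc]
  have e : 1 / p.conjExponent = 1 - 1/p := by
    rw [Real.conjExponent]; field_simp
  rw [e]
  gcongr
  calc (∫⁻ z in B, g (a + t • z) ^ p) ^ (1/p) ≤ (∫⁻ z, g (a + t • z) ^ p) ^ (1/p) := by
        gcongr
        exact Measure.restrict_le_self
    _ = _ := by
        rw [scale (fun z => g z ^ p) (by fun_prop) a t ht, ENNReal.mul_rpow_of_nonneg _ _ (by positivity),
          ENNReal.ofReal_rpow_of_nonneg (by positivity) (by positivity), ← Real.rpow_mul ht.le]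
        congr 3
        ring

lemma t_int (a : ℝ) (ha : a < 1) :
    ∫⁻ t in Ioc (0:ℝ) 1, ENNReal.ofReal (t ^ (-a)) = ENNReal.ofReal (1 / (1 - a)) := by
  rw [← ofReal_integral_eq_lintegral_ofReal]
  · rw [← intervalIntegral.integral_of_le zero_le_one, integral_rpow (Or.inl (by linarith)),
      Real.zero_rpow (by linarith)]
    congr 1
    simp [add_comm, sub_eq_add_neg]
  · exact (intervalIntegrable_iff_integrableOn_Ioc_of_le zero_le_one).1
      (intervalIntegral.intervalIntegrable_rpow' (by linarith))
  · filter_upwards [ae_restrict_mem measurableSet_Ioc] with t ht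
    exact Real.rpow_nonneg ht.1.le _

lemma morrey {N : ℕ} (u : EuclideanSpace ℝ (Fin N) → ℝ) (hu : ContDiff ℝ 1 u) (p : ℝ)
    (hp1 : 1 < p) (hpN : (N:ℝ) < p) (x m : EuclideanSpace ℝ (Fin N)) (ε D : ℝ)
    (hD : ‖m - x‖ + ε ≤ D) (hz : ∀ z ∈ ball m ε, u z = 0) :
    ‖u x‖ₑ * volume (ball (0 : EuclideanSpace ℝ (Fin N)) ε) ≤
      ENNReal.ofReal D * (ENNReal.ofReal (1 / (1 - N/p)) *
      ((∫⁻ z, ‖fderiv ℝ u z‖ₑ ^ p) ^ (1/p) *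
        volume (ball (0 : EuclideanSpace ℝ (Fin N)) ε) ^ (1 - 1/p))) := by
  set B := ball (0 : EuclideanSpace ℝ (Fin N)) ε
  have hcf := hu.continuous_fderiv one_ne_zero
  calc ‖u x‖ₑ * volume B = ∫⁻ z in B, ‖u x‖ₑ := by
        simp
    _ ≤ ∫⁻ z in B, ENNReal.ofReal D *
          ∫⁻ t in Ioc (0:ℝ) 1, ‖fderiv ℝ u ((x + t • (m - x)) + t • z)‖ₑ := by
        refine setLIntegral_mono_ae' measurableSet_ball (Eventually.of_forall fun z hzB => ?_)
        have hzn : ‖z‖ < ε := by simpa [B] using hzB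
        have h := morrey1 u hu x (m + z) D (by
          calc ‖m + z - x‖ = ‖(m - x) + z‖ := by congr 1; abel
            _ ≤ ‖m - x‖ + ‖z‖ := norm_add_le _ _
            _ ≤ D := by linarith) (hz _ (by simpa using hzn))
        convert h using 6 with t
        module
    _ = ENNReal.ofReal D * ∫⁻ t in Ioc (0:ℝ) 1, ∫⁻ z in B,
          ‖fderiv ℝ u ((x + t • (m - x)) + t • z)‖ₑ := by
        rw [lintegral_const_mul' _ _ ENNReal.ofReal_ne_top, lintegral_lintegral_swap]
        apply Measurable.aemeasurable
        apply Continuous.measurable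
        simp only [Function.uncurry_def]
        fun_prop
    _ ≤ ENNReal.ofReal D * ∫⁻ t in Ioc (0:ℝ) 1, ENNReal.ofReal (t ^ (-((N:ℝ)/p))) *
          ((∫⁻ z, ‖fderiv ℝ u z‖ₑ ^ p) ^ (1/p) * volume B ^ (1 - 1/p)) := by
        gcongr ENNReal.ofReal D * ?_
        refine setLIntegral_mono_ae' (measurableSet_Ioc (α := ℝ)) (Eventually.of_forall fun t ht => ?_)
        have := inner_est (fun z => ‖fderiv ℝ u z‖ₑ) (by fun_prop) p hp1 (x + t • (m - x)) t ht.1 B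
        rwa [neg_div] at this
    _ = _ := by
        rw [lintegral_mul_const, t_int]
        · rw [div_lt_one (by linarith)]; exact hpN
        · fun_prop

lemma morrey_real {N : ℕ} (u : EuclideanSpace ℝ (Fin N) → ℝ) (hu : ContDiff ℝ 1 u)
    (hc : HasCompactSupport u) (p : ℝ)
    (hp1 : 1 < p) (hpN : (N:ℝ) < p) (x m : EuclideanSpace ℝ (Fin N)) (ε D : ℝ) (hε : 0 < ε)
    (hD : ‖m - x‖ + ε ≤ D) (hz : ∀ z ∈ ball m ε, u z = 0) :
    |u x| ^ p ≤ (D / (1 - N/p)) ^ p * (∫ z, ‖fderiv ℝ u z‖ ^ p) /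
      volume.real (ball (0 : EuclideanSpace ℝ (Fin N)) ε) := by
  have h := morrey u hu p hp1 hpN x m ε D hD hz
  have hD0 : 0 ≤ D := le_trans (by positivity) hD
  have hp0 : 0 < p := by linarith
  have hq : 0 < 1 - N / p := by
    rw [sub_pos, div_lt_one hp0]; exact hpN
  set B := ball (0 : EuclideanSpace ℝ (Fin N)) ε with hB
  have hVpos : 0 < volume.real B := by
    rw [Measure.real, ENNReal.toReal_pos_iff]
    exact ⟨measure_ball_pos _ _ hε, measure_ball_lt_top⟩
  have hVe : volume B = ENNReal.ofReal (volume.real B) := by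
    rw [Measure.real, ENNReal.ofReal_toReal measure_ball_lt_top.ne]
  set V := volume.real B
  have hcf := hu.continuous_fderiv one_ne_zero
  have hGint : Integrable (fun z => ‖fderiv ℝ u z‖ ^ p) := by
    apply Continuous.integrable_of_hasCompactSupport
    · exact hcf.norm.rpow_const (fun _ => Or.inr hp0.le)
    · have := hc.fderiv (𝕜 := ℝ)
      exact this.comp_left (g := fun L => ‖L‖ ^ p) (by simp [hp0.ne'])
  have hG : ∫⁻ z, ‖fderiv ℝ u z‖ₑ ^ p = ENNReal.ofReal (∫ z, ‖fderiv ℝ u z‖ ^ p) := by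
    rw [ofReal_integral_eq_lintegral_ofReal hGint (Eventually.of_forall fun z => by positivity)]
    refine lintegral_congr fun z => ?_
    rw [← ENNReal.ofReal_rpow_of_nonneg (norm_nonneg _) hp0.le, ofReal_norm]
  have hG0 : 0 ≤ ∫ z, ‖fderiv ℝ u z‖ ^ p := integral_nonneg fun z => by positivity
  rw [hG, hVe] at h
  set G := ∫ z, ‖fderiv ℝ u z‖ ^ p
  have h1p : 0 ≤ 1 - 1/p := by
    rw [sub_nonneg, div_le_one hp0]; exact hp1.le
  rw [ENNReal.ofReal_rpow_of_nonneg hG0 (by positivity), ENNReal.ofReal_rpow_of_nonneg hVpos.le h1p,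
    ← ofReal_norm, ← ENNReal.ofReal_mul (by positivity), ← ENNReal.ofReal_mul (by positivity),
    ← ENNReal.ofReal_mul (by positivity), ← ENNReal.ofReal_mul (by positivity),
    ENNReal.ofReal_le_ofReal_iff (by positivity)] at h
  have h2 : |u x| ≤ D / (1 - N/p) * G ^ (1/p) * V ^ (-(1/p)) := by
    have e : V ^ (1 - 1/p) = V * V ^ (-(1/p)) := by
      rw [sub_eq_add_neg, Real.rpow_add hVpos, Real.rpow_one]
    rw [e, Real.norm_eq_abs] at h
    refine le_of_mul_le_mul_right (h.trans (le_of_eq ?_)) hVpos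
    ring
  have h3 := Real.rpow_le_rpow (abs_nonneg _) h2 hp0.le
  refine h3.trans (le_of_eq ?_)
  rw [Real.mul_rpow (by positivity) (by positivity), Real.mul_rpow (by positivity) (by positivity),
    ← Real.rpow_mul hG0, ← Real.rpow_mul hVpos.le]
  have e1 : 1 / p * p = 1 := by field_simp
  have e2 : -(1 / p) * p = -1 := by field_simp
  rw [e1, e2, Real.rpow_one, Real.rpow_neg_one]
  rfl

lemma psi_exists (ε : ℝ) (hε : 0 < ε) : ∃ ψ : ℝ → ℝ, ContDiff ℝ (⊤ : ℕ∞) ψ ∧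
    LipschitzWith 1 ψ ∧ (∀ t ≤ 0, ψ t = 0) ∧ ∀ t, ε ≤ t → t - ε ≤ ψ t := by
  let σ : ℝ → ℝ := fun t => Real.smoothTransition (t / ε)
  have hσ : ContDiff ℝ (⊤ : ℕ∞) σ := Real.smoothTransition.contDiff.comp (contDiff_id.div_const _)
  have hσc : Continuous σ := hσ.continuous
  have hd : ∀ t, HasDerivAt (fun t => ∫ τ in (0:ℝ)..t, σ τ) (σ t) t := fun t =>
    intervalIntegral.integral_hasDerivAt_right (hσc.intervalIntegrable _ _)
      (hσc.stronglyMeasurableAtFilter _ _) hσc.continuousAt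
  have hderiv : deriv (fun t => ∫ τ in (0:ℝ)..t, σ τ) = σ := funext fun t => (hd t).deriv
  refine ⟨fun t => ∫ τ in (0:ℝ)..t, σ τ, ?_, ?_, ?_, ?_⟩
  · rw [contDiff_infty_iff_deriv, hderiv]
    exact ⟨fun t => (hd t).differentiableAt, hσ⟩
  · apply lipschitzWith_of_nnnorm_deriv_le (fun t => (hd t).differentiableAt)
    intro t
    rw [hderiv, ← NNReal.coe_le_coe, coe_nnnorm, Real.norm_eq_abs,
      abs_of_nonneg (Real.smoothTransition.nonneg _)]
    exact Real.smoothTransition.le_one _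
  · intro t ht
    have : ∫ τ in (0:ℝ)..t, σ τ = ∫ τ in (0:ℝ)..t, (0:ℝ) := by
      apply intervalIntegral.integral_congr
      intro τ hτ
      rw [uIcc_of_ge ht] at hτ
      exact Real.smoothTransition.zero_of_nonpos (div_nonpos_of_nonpos_of_nonneg hτ.2 hε.le)
    simpa using this
  · intro t ht
    show t - ε ≤ ∫ τ in (0:ℝ)..t, σ τ
    rw [← intervalIntegral.integral_add_adjacent_intervals (b := ε)
      (hσc.intervalIntegrable _ _) (hσc.intervalIntegrable _ _)]
    have h1 : 0 ≤ ∫ τ in (0:ℝ)..ε, σ τ :=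
      intervalIntegral.integral_nonneg hε.le fun τ _ => Real.smoothTransition.nonneg _
    have h2 : ∫ τ in ε..t, σ τ = ∫ τ in ε..t, (1:ℝ) := by
      apply intervalIntegral.integral_congr
      intro τ hτ
      rw [uIcc_of_le ht] at hτ
      exact Real.smoothTransition.one_of_one_le ((one_le_div hε).2 hτ.1)
    rw [h2]
    simp
    linarith

lemma test_exists {N : ℕ} (c : EuclideanSpace ℝ (Fin N)) (r ε : ℝ) (hε : 0 < ε) (hr : 4 * ε < r) :
    ∃ u : EuclideanSpace ℝ (Fin N) → ℝ, ContDiff ℝ (⊤ : ℕ∞) u ∧ HasCompactSupport u ∧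
      tsupport u ⊆ ball c r ∧ (∀ x, ‖gradient u x‖ ≤ 1) ∧ ∀ x ∈ ball c ε, r - 4 * ε ≤ u x := by
  obtain ⟨ψ, h1, h2, h3, h4⟩ := psi_exists ε hε
  have hpos : ∀ x, 0 < ε ^ 2 + ‖x - c‖ ^ 2 := fun x => by positivity
  let f : EuclideanSpace ℝ (Fin N) → ℝ := fun x => r - ε - √(ε ^ 2 + ‖x - c‖ ^ 2)
  have hf : ContDiff ℝ (⊤ : ℕ∞) f := by
    refine contDiff_const.sub (ContDiff.sqrt ?_ fun x => (hpos x).ne')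
    exact contDiff_const.add ((contDiff_id.sub contDiff_const).norm_sq ℝ)
  have hfl : LipschitzWith 1 f := by
    apply LipschitzWith.of_dist_le_mul
    intro x y
    have key : ∀ x y : EuclideanSpace ℝ (Fin N),
        √(ε ^ 2 + ‖x - c‖ ^ 2) ≤ √(ε ^ 2 + ‖y - c‖ ^ 2) + dist x y := by
      intro x y
      have ht : ‖x - c‖ ≤ ‖y - c‖ + dist x y := by
        rw [← dist_eq_norm, ← dist_eq_norm, add_comm]; exact dist_triangle _ _ _
      have hs : ‖y - c‖ ≤ √(ε ^ 2 + ‖y - c‖ ^ 2) := by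
        apply Real.le_sqrt_of_sq_le; nlinarith
      have hd : 0 ≤ dist x y := dist_nonneg
      apply Real.sqrt_le_iff.2
      refine ⟨by positivity, ?_⟩
      have := Real.sq_sqrt (hpos y).le
      nlinarith [norm_nonneg (x - c), norm_nonneg (y - c), mul_le_mul_of_nonneg_right hs hd]
    rw [Real.dist_eq, NNReal.coe_one, one_mul, abs_le]
    have k1 := key x y
    have k2 := key y x
    rw [dist_comm] at k2
    constructor <;> simp only [f] <;> linarith
  have hsub : tsupport (ψ ∘ f) ⊆ closedBall c (r - ε) := by
    apply closure_minimal _ isClosed_closedBall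
    intro x hx
    by_contra hxc
    apply hx
    apply h3
    simp only [mem_closedBall, not_le, dist_eq_norm] at hxc
    have hs : ‖x - c‖ ≤ √(ε ^ 2 + ‖x - c‖ ^ 2) := by
      apply Real.le_sqrt_of_sq_le; nlinarith
    simp only [f]; linarith
  refine ⟨ψ ∘ f, h1.comp hf, ?_, ?_, ?_, ?_⟩
  · exact HasCompactSupport.of_support_subset_isCompact (isCompact_closedBall c (r - ε))
      (subset_closure.trans hsub)
  · exact hsub.trans (closedBall_subset_ball (by linarith))
  · intro x
    have := norm_fderiv_le_of_lipschitz ℝ (x₀ := x) (h2.comp hfl)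
    rw [gradient, LinearIsometryEquiv.norm_map]
    simpa using this
  · intro x hx
    rw [mem_ball, dist_eq_norm] at hx
    have hs : √(ε ^ 2 + ‖x - c‖ ^ 2) ≤ 2 * ε := by
      apply Real.sqrt_le_iff.2
      constructor
      · positivity
      · nlinarith [norm_nonneg (x - c)]
    have := h4 (f x) (by simp only [f]; linarith)
    simp only [f, Function.comp] at this ⊢
    linarith

lemma norm_e1 {N : ℕ} (hN : 2 ≤ N) : ‖e1 N‖ = 1 := by
  have : e1 N = EuclideanSpace.single (⟨0, by omega⟩ : Fin N) (1:ℝ) := by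
    ext i
    simp [e1, Fin.ext_iff]
  rw [this]; simp

lemma inball {N : ℕ} (hN : 2 ≤ N) (R₀ R₁ s : ℝ) (hR₀ : 0 < R₀) (hR : R₀ < R₁) (hs : 0 ≤ s)
    (hs' : s < R₁ + R₀) : ball (((s - R₀ - R₁) / 2) • e1 N) ((R₁ - R₀ + s) / 2) ⊆ Om N R₀ R₁ s := by
  intro x hx
  rw [mem_ball, dist_eq_norm] at hx
  have n1 : ‖((s - R₀ - R₁) / 2) • e1 N‖ = (R₁ + R₀ - s) / 2 := by
    rw [norm_smul, norm_e1 hN, Real.norm_eq_abs, abs_of_neg (by linarith)]; ring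
  have n2 : ‖s • e1 N - ((s - R₀ - R₁) / 2) • e1 N‖ = (s + R₀ + R₁) / 2 := by
    rw [← sub_smul, norm_smul, norm_e1 hN, Real.norm_eq_abs, abs_of_pos (by linarith)]; ring
  rw [Om, closure_ball _ hR₀.ne']
  constructor
  · rw [mem_ball_zero_iff]
    have := norm_add_le (x - ((s - R₀ - R₁) / 2) • e1 N) (((s - R₀ - R₁) / 2) • e1 N)
    rw [sub_add_cancel] at this
    linarith
  · rw [mem_closedBall, dist_eq_norm, not_le]
    have := norm_sub_le_norm_sub_add_norm_sub (s • e1 N) x (((s - R₀ - R₁) / 2) • e1 N)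
    rw [norm_sub_rev (s • e1 N) x] at this
    linarith

lemma outball {N : ℕ} (hN : 2 ≤ N) (R₀ R₁ s : ℝ) (hR₀ : 0 < R₀) (hR : R₀ < R₁) (hs : 0 ≤ s)
    (hs' : s < R₁ + R₀) (ε : ℝ) (hε : 0 < ε) (hε' : ε < R₀) (x : EuclideanSpace ℝ (Fin N))
    (hx : x ∈ Om N R₀ R₁ s) :
    ∃ m, ‖m - x‖ ≤ (R₁ - R₀ + s) / 2 + ε ∧ ∀ z ∈ ball m ε, z ∉ Om N R₀ R₁ s := by
  rw [Om, closure_ball _ hR₀.ne'] at *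
  obtain ⟨hx1, hx2⟩ := hx
  rw [mem_ball_zero_iff] at hx1
  rw [mem_closedBall, dist_eq_norm, not_le] at hx2
  by_cases h : R₁ - ‖x‖ ≤ (R₁ - R₀ + s) / 2
  · have hx0 : 0 < ‖x‖ := by linarith
    refine ⟨((R₁ + ε) / ‖x‖) • x, ?_, ?_⟩
    · have : ((R₁ + ε) / ‖x‖) • x - x = ((R₁ + ε) / ‖x‖ - 1) • x := by module
      rw [this, norm_smul, Real.norm_eq_abs, abs_of_nonneg, sub_mul, div_mul_cancel₀ _ hx0.ne']
      · linarith
      · rw [sub_nonneg, one_le_div hx0]; linarith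
    · rintro z hz ⟨hz1, -⟩
      rw [mem_ball_zero_iff] at hz1
      rw [mem_ball, dist_eq_norm, norm_sub_rev] at hz
      have n : ‖((R₁ + ε) / ‖x‖) • x‖ = R₁ + ε := by
        rw [norm_smul, Real.norm_eq_abs, abs_of_nonneg (div_nonneg (by linarith) hx0.le),
          div_mul_cancel₀ _ hx0.ne']
      have := norm_sub_norm_le (((R₁ + ε) / ‖x‖) • x) z
      linarith
  · push Not at h
    set y := x - s • e1 N with hy
    have hy0 : 0 < ‖y‖ := by linarith
    have hyx : ‖y‖ ≤ ‖x‖ + s := by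
      have := norm_sub_le x (s • e1 N)
      rwa [norm_smul, norm_e1 hN, Real.norm_eq_abs, abs_of_nonneg hs, mul_one] at this
    refine ⟨s • e1 N + ((R₀ - ε) / ‖y‖) • y, ?_, ?_⟩
    · have : s • e1 N + ((R₀ - ε) / ‖y‖) • y - x = -((1 - (R₀ - ε) / ‖y‖) • y) := by
        have : x = s • e1 N + y := by rw [hy]; abel
        rw [this]; module
      rw [this, norm_neg, norm_smul, Real.norm_eq_abs, abs_of_nonneg, sub_mul, div_mul_cancel₀ _ hy0.ne']
      · linarith
      · rw [sub_nonneg, div_le_one hy0]; linarith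
    · rintro z hz ⟨-, hz2⟩
      rw [mem_closedBall, dist_eq_norm, not_le] at hz2
      rw [mem_ball, dist_eq_norm] at hz
      have n : ‖((R₀ - ε) / ‖y‖) • y‖ = R₀ - ε := by
        rw [norm_smul, Real.norm_eq_abs, abs_of_nonneg (div_nonneg (by linarith) hy0.le), div_mul_cancel₀ _ hy0.ne']
      have := norm_add_le (z - (s • e1 N + ((R₀ - ε) / ‖y‖) • y)) (((R₀ - ε) / ‖y‖) • y)
      have e : z - (s • e1 N + ((R₀ - ε) / ‖y‖) • y) + (((R₀ - ε) / ‖y‖) • y) = z - s • e1 N := by abel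
      rw [e] at this
      linarith

lemma Om_open (N : ℕ) (R₀ R₁ s : ℝ) : IsOpen (Om N R₀ R₁ s) :=
  isOpen_ball.sdiff isClosed_closure

lemma Om_lt_top (N : ℕ) (R₀ R₁ s : ℝ) : volume (Om N R₀ R₁ s) < ⊤ :=
  (measure_mono sdiff_subset).trans_lt measure_ball_lt_top

lemma norm_gradient_eq {N : ℕ} (u : EuclideanSpace ℝ (Fin N) → ℝ) (x : EuclideanSpace ℝ (Fin N)) :
    ‖gradient u x‖ = ‖fderiv ℝ u x‖ := by
  rw [gradient, LinearIsometryEquiv.norm_map]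

lemma int_pow {N : ℕ} (u : EuclideanSpace ℝ (Fin N) → ℝ) (hu : Continuous u)
    (hc : HasCompactSupport u) (p : ℝ) (hp : 0 < p) : Integrable (fun x => |u x| ^ p) := by
  apply Continuous.integrable_of_hasCompactSupport
  · exact hu.abs.rpow_const (fun _ => Or.inr hp.le)
  · exact hc.comp_left (g := fun L => |L| ^ p) (by simp [hp.ne'])

lemma quot_bound {N : ℕ} (Ω : Set (EuclideanSpace ℝ (Fin N))) (hΩ : IsOpen Ω)
    (hfin : volume Ω < ⊤) (p : ℝ) (hp1 : 1 < p) (hpN : (N:ℝ) < p) (ε D : ℝ) (hε : 0 < ε)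
    (hD : 0 < D) (hM : 0 < volume.real Ω)
    (hout : ∀ x ∈ Ω, ∃ m, ‖m - x‖ + ε ≤ D ∧ ∀ z ∈ ball m ε, z ∉ Ω)
    (u : EuclideanSpace ℝ (Fin N) → ℝ) (hu : ContDiff ℝ (⊤ : ℕ∞) u) (hne : u ≠ 0)
    (hc : HasCompactSupport u) (hsup : tsupport u ⊆ Ω) :
    volume.real (ball (0 : EuclideanSpace ℝ (Fin N)) ε) / volume.real Ω * ((1 - N/p) / D) ^ p ≤
      (∫ x in Ω, ‖gradient u x‖ ^ p) / (∫ x in Ω, |u x| ^ p) := by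
  have hp0 : 0 < p := by linarith
  have hq : 0 < 1 - N / p := by
    rw [sub_pos, div_lt_one hp0]; exact hpN
  have hV : 0 < volume.real (ball (0 : EuclideanSpace ℝ (Fin N)) ε) := by
    rw [Measure.real, ENNReal.toReal_pos_iff]
    exact ⟨measure_ball_pos _ _ hε, measure_ball_lt_top⟩
  have hu1 : ContDiff ℝ 1 u := hu.of_le (by exact_mod_cast le_top)
  have hu0 : ∀ x, x ∉ Ω → u x = 0 := fun x hx => image_eq_zero_of_notMem_tsupport fun h => hx (hsup h)
  have hg0 : ∀ x, x ∉ Ω → ‖gradient u x‖ ^ p = 0 := by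
    intro x hx
    have : fderiv ℝ u x = 0 := image_eq_zero_of_notMem_tsupport
      fun h => hx (hsup (tsupport_fderiv_subset ℝ h))
    rw [norm_gradient_eq, this]; simp [hp0.ne']
  have eG : ∫ x in Ω, ‖gradient u x‖ ^ p = ∫ x, ‖fderiv ℝ u x‖ ^ p := by
    rw [setIntegral_eq_integral_of_forall_compl_eq_zero hg0]
    simp_rw [norm_gradient_eq]
  have hint := int_pow u hu.continuous hc p hp0
  have hUpos : 0 < ∫ x in Ω, |u x| ^ p := by
    rw [setIntegral_eq_integral_of_forall_compl_eq_zero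
      (fun x hx => by simp [hu0 x hx, hp0.ne'])]
    obtain ⟨x, hx⟩ := Function.ne_iff.1 hne
    refine integral_pos_of_integrable_nonneg_nonzero (x := x) ?_ hint
      (fun x => by positivity) ?_
    · exact hu.continuous.abs.rpow_const (fun _ => Or.inr hp0.le)
    · have : 0 < |u x| := abs_pos.2 hx
      positivity
  rw [eG]
  set G := ∫ x, ‖fderiv ℝ u x‖ ^ p
  set V := volume.real (ball (0 : EuclideanSpace ℝ (Fin N)) ε)
  have hU : ∫ x in Ω, |u x| ^ p ≤ ∫ x in Ω, (D / (1 - N/p)) ^ p * G / V := by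
    refine setIntegral_mono_on hint.integrableOn (integrableOn_const hfin.ne) hΩ.measurableSet ?_
    intro x hx
    obtain ⟨m, hm, hz⟩ := hout x hx
    exact morrey_real u hu1 hc p hp1 hpN x m ε D hε hm fun z h => hu0 z (hz z h)
  rw [setIntegral_const, smul_eq_mul] at hU
  rw [le_div_iff₀ hUpos]
  refine (mul_le_mul_of_nonneg_left hU (by positivity)).trans (le_of_eq ?_)
  have e : ((1 - N/p) / D) ^ p * (D / (1 - N/p)) ^ p = 1 := by
    rw [← Real.mul_rpow (by positivity) (by positivity)]
    have : ((1 - N/p) / D) * (D / (1 - N/p)) = 1 := by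
      rw [div_mul_div_comm, mul_comm, div_self (mul_pos hD hq).ne']
    rw [this, Real.one_rpow]
  calc V / volume.real Ω * ((1 - ↑N / p) / D) ^ p * (volume.real Ω * ((D / (1 - ↑N / p)) ^ p * G / V))
      = (((1 - N/p) / D) ^ p * (D / (1 - N/p)) ^ p) * ((V / V) * (volume.real Ω / volume.real Ω) * G) := by ring
    _ = G := by rw [e, div_self hV.ne', div_self hM.ne']; ring

lemma quot_upper {N : ℕ} (Ω : Set (EuclideanSpace ℝ (Fin N)))
    (hfin : volume Ω < ⊤) (p : ℝ) (hp0 : 0 < p) (c : EuclideanSpace ℝ (Fin N)) (r ε : ℝ)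
    (hε : 0 < ε) (hr : 4 * ε < r) (hsub : ball c r ⊆ Ω)
    (u : EuclideanSpace ℝ (Fin N) → ℝ) (hu : ContDiff ℝ (⊤ : ℕ∞) u)
    (hc : HasCompactSupport u) (hg : ∀ x, ‖gradient u x‖ ≤ 1)
    (hlow : ∀ x ∈ ball c ε, r - 4 * ε ≤ u x) :
    (∫ x in Ω, ‖gradient u x‖ ^ p) / (∫ x in Ω, |u x| ^ p) ≤
      volume.real Ω / volume.real (ball c ε) * (1 / (r - 4 * ε)) ^ p := by
  have hV : 0 < volume.real (ball c ε) := by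
    rw [Measure.real, ENNReal.toReal_pos_iff]
    exact ⟨measure_ball_pos _ _ hε, measure_ball_lt_top⟩
  have hr' : 0 < r - 4 * ε := by linarith
  have hint := int_pow u hu.continuous hc p hp0
  have h1 : ∫ x in Ω, ‖gradient u x‖ ^ p ≤ volume.real Ω := by
    have : ∫ x in Ω, ‖gradient u x‖ ^ p ≤ ∫ x in Ω, (1:ℝ) := by
      refine integral_mono_of_nonneg (Eventually.of_forall fun x => by positivity)
        (integrableOn_const hfin.ne) (Eventually.of_forall fun x => ?_)
      exact Real.rpow_le_one (norm_nonneg _) (hg x) hp0.le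
    simpa using this
  have h2 : volume.real (ball c ε) * (r - 4 * ε) ^ p ≤ ∫ x in Ω, |u x| ^ p := by
    calc volume.real (ball c ε) * (r - 4 * ε) ^ p = ∫ x in ball c ε, (r - 4 * ε) ^ p := by
          rw [setIntegral_const, smul_eq_mul]
      _ ≤ ∫ x in ball c ε, |u x| ^ p := by
          refine setIntegral_mono_on (integrableOn_const measure_ball_lt_top.ne) hint.integrableOn
            measurableSet_ball fun x hx => ?_
          exact Real.rpow_le_rpow hr'.le ((hlow x hx).trans (le_abs_self _)) hp0.le
      _ ≤ _ := by
          refine setIntegral_mono_set hint.integrableOn (Eventually.of_forall fun x => by positivity) ?_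
          exact ((ball_subset_ball (by linarith)).trans hsub).eventuallyLE
  calc (∫ x in Ω, ‖gradient u x‖ ^ p) / (∫ x in Ω, |u x| ^ p)
      ≤ volume.real Ω / (volume.real (ball c ε) * (r - 4 * ε) ^ p) := by
        gcongr
    _ = _ := by
        rw [Real.div_rpow zero_le_one hr'.le, Real.one_rpow]
        field_simp

lemma root_tendsto (C : ℝ) (hC : 0 < C) : Tendsto (fun p : ℝ => C ^ (1 / p)) atTop (𝓝 1) := by
  have h : Tendsto (fun p : ℝ => 1 / p) atTop (𝓝 0) := by
    simpa using tendsto_inv_atTop_zero (𝕜 := ℝ)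
  have := (Real.continuousAt_const_rpow hC.ne' (b := 0)).tendsto.comp h
  simpa [Function.comp_def] using this

theorem stmt5 (N : ℕ) (hN : 2 ≤ N) (R₀ R₁ : ℝ) (hR₀ : 0 < R₀) (hR : R₀ < R₁)
    (s : ℝ) (hs : 0 ≤ s) (hs' : s < R₁ + R₀) (L : ℝ)
    (hL : Tendsto (fun p : ℝ => (lam1 p (Om N R₀ R₁ s)) ^ (1 / p)) atTop (nhds L)) :
    L = 2 / (R₁ - R₀ + s) := by
  set r := (R₁ - R₀ + s) / 2 with hr
  have hr0 : 0 < r := by rw [hr]; linarith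
  have hgoal : 2 / (R₁ - R₀ + s) = 1 / r := by rw [hr]; field_simp
  rw [hgoal]
  set Ω := Om N R₀ R₁ s with hΩ
  have hfin : volume Ω < ⊤ := Om_lt_top N R₀ R₁ s
  set c := ((s - R₀ - R₁) / 2) • e1 N
  have hsub : ball c r ⊆ Ω := inball hN R₀ R₁ s hR₀ hR hs hs'
  have hM : 0 < volume.real Ω := by
    rw [Measure.real, ENNReal.toReal_pos_iff]
    exact ⟨(measure_ball_pos _ _ hr0).trans_le (measure_mono hsub), hfin⟩
  have hV : ∀ (x : EuclideanSpace ℝ (Fin N)) (ε : ℝ), 0 < ε → 0 < volume.real (ball x ε) := by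
    intro x ε hε
    rw [Measure.real, ENNReal.toReal_pos_iff]
    exact ⟨measure_ball_pos _ _ hε, measure_ball_lt_top⟩
  have hnonneg : ∀ p, 0 ≤ lam1 p Ω := by
    intro p
    apply Real.sInf_nonneg
    rintro _ ⟨u, -, -, -, -, rfl⟩
    exact div_nonneg (integral_nonneg fun x => by positivity) (integral_nonneg fun x => by positivity)
  -- the upper bound
  have hup : ∀ ε, 0 < ε → 4 * ε < r → L ≤ 1 / (r - 4 * ε) := by
    intro ε hε hεr
    have hr' : 0 < r - 4 * ε := by linarith
    obtain ⟨u, hu, hc, hsup, hg, hlow⟩ := test_exists c r ε hε hεr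
    have hne : u ≠ 0 := by
      rintro rfl
      have := hlow c (mem_ball_self hε)
      simp at this; linarith
    set C := volume.real Ω / volume.real (ball c ε)
    have hC : 0 < C := div_pos hM (hV c ε hε)
    have ht : Tendsto (fun p : ℝ => C ^ (1 / p) * (1 / (r - 4 * ε))) atTop
        (𝓝 (1 * (1 / (r - 4 * ε)))) := (root_tendsto C hC).mul_const _
    rw [one_mul] at ht
    refine le_of_tendsto_of_tendsto hL ht ?_
    filter_upwards [eventually_gt_atTop 0] with p hp
    have h1 : lam1 p Ω ≤ C * (1 / (r - 4 * ε)) ^ p := by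
      refine le_trans ?_ (quot_upper Ω hfin p hp c r ε hε hεr hsub u hu hc hg hlow)
      refine csInf_le ?_ ⟨u, hu, hne, hc, hsup.trans hsub, rfl⟩
      refine ⟨0, ?_⟩
      rintro _ ⟨u, -, -, -, -, rfl⟩
      exact div_nonneg (integral_nonneg fun x => by positivity)
        (integral_nonneg fun x => by positivity)
    have h2 := Real.rpow_le_rpow (hnonneg p) h1 (z := 1 / p) (by positivity)
    refine h2.trans (le_of_eq ?_)
    rw [Real.mul_rpow hC.le (by positivity), ← Real.rpow_mul (by positivity),
      mul_one_div_cancel hp.ne', Real.rpow_one]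
  -- the lower bound
  have hlo : ∀ ε, 0 < ε → ε < R₀ → 1 / (r + 2 * ε) ≤ L := by
    intro ε hε hεR
    have hD : 0 < r + 2 * ε := by linarith
    set C := volume.real (ball (0 : EuclideanSpace ℝ (Fin N)) ε) / volume.real Ω
    have hC : 0 < C := div_pos (hV 0 ε hε) hM
    have ht : Tendsto (fun p : ℝ => C ^ (1 / p) * ((1 - N / p) / (r + 2 * ε))) atTop
        (𝓝 (1 * ((1 - 0) / (r + 2 * ε)))) := by
      refine (root_tendsto C hC).mul (Tendsto.div_const (tendsto_const_nhds.sub ?_) _)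
      exact tendsto_const_nhds.div_atTop tendsto_id
    rw [one_mul, sub_zero] at ht
    refine le_of_tendsto_of_tendsto ht hL ?_
    filter_upwards [eventually_gt_atTop 1, eventually_gt_atTop (N:ℝ)] with p hp1 hpN
    have hp0 : 0 < p := by linarith
    have hq : 0 < 1 - N / p := by
      rw [sub_pos, div_lt_one hp0]; exact hpN
    have h1 : C * ((1 - N / p) / (r + 2 * ε)) ^ p ≤ lam1 p Ω := by
      apply le_csInf
      · obtain ⟨u, hu, hc, hsup, hg, hlow⟩ := test_exists c r (r / 8) (by linarith) (by linarith)
        refine ⟨_, u, hu, ?_, hc, hsup.trans hsub, rfl⟩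
        rintro rfl
        have := hlow c (mem_ball_self (by linarith))
        simp at this; linarith
      · rintro _ ⟨u, hu, hne, hc, hsup, rfl⟩
        refine quot_bound Ω (Om_open N R₀ R₁ s) hfin p hp1 hpN ε (r + 2 * ε) hε hD hM ?_ u hu hne hc hsup
        intro x hx
        obtain ⟨m, hm, hz⟩ := outball hN R₀ R₁ s hR₀ hR hs hs' ε hε hεR x hx
        exact ⟨m, by linarith, hz⟩
    have h2 := Real.rpow_le_rpow (by positivity) h1 (z := 1 / p) (by positivity)
    refine (le_of_eq ?_).trans h2
    rw [Real.mul_rpow hC.le (by positivity), ← Real.rpow_mul (by positivity),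
      mul_one_div_cancel hp0.ne', Real.rpow_one]
  have hz : Tendsto (fun ε : ℝ => ε) (𝓝[>] 0) (𝓝 0) := tendsto_id.mono_left nhdsWithin_le_nhds
  apply le_antisymm
  · have ht : Tendsto (fun ε : ℝ => 1 / (r - 4 * ε)) (𝓝[>] 0) (𝓝 (1 / (r - 4 * 0))) :=
      tendsto_const_nhds.div (tendsto_const_nhds.sub (hz.const_mul 4)) (by simpa using hr0.ne')
    rw [mul_zero, sub_zero] at ht
    refine ge_of_tendsto ht ?_
    filter_upwards [Ioo_mem_nhdsGT (show (0:ℝ) < r / 4 by linarith)] with ε hε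
    exact hup ε hε.1 (by linarith [hε.2])
  · have ht : Tendsto (fun ε : ℝ => 1 / (r + 2 * ε)) (𝓝[>] 0) (𝓝 (1 / (r + 2 * 0))) :=
      tendsto_const_nhds.div (tendsto_const_nhds.add (hz.const_mul 2)) (by simpa using hr0.ne')
    rw [mul_zero, add_zero] at ht
    refine le_of_tendsto ht ?_
    filter_upwards [Ioo_mem_nhdsGT hR₀] with ε hε
    exact hlo ε hε.1 hε.2
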